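/- Let w : ℝ^m → ℂ be a Borel function in the Kato class K(ℝ^m), and for n ≥ 1, t ≥ 0, x ∈ ℝ^m set a_n(x,t) := ∫_{0 ≤ q_1 ≤ … ≤ q_n ≤ t} ∫_{(ℝ^m)^n} Π_{i=1}^n [ p(q_i − q_{i−1}, x_{i−1}, x_i) |w(x_i)| ] dx_1 … dx_n dq_1 … dq_n, with q_0 := 0, x_0 := x, and a_0(x,t) := 1. Then for every δ > 1 there exists a constant C = C(w,δ) > 0 such that for all t ≥ 0: sup_{x∈ℝ^m} Σ_{n=0}^∞ a_n(x,t) ≤ δ · e^{tC}. -/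

import Mathlib

open MeasureTheory Filter ENNReal

noncomputable section

abbrev Em (m : ℕ) := EuclideanSpace ℝ (Fin m)

/-- The heat kernel `p(t,x,y) = (2πt)^{-m/2} exp(-|x-y|²/(2t))` of `Δ/2` on `ℝ^m`. -/
def heatk (m : ℕ) (t : ℝ) (x y : Em m) : ℝ :=
  (2 * Real.pi * t) ^ (-(m : ℝ) / 2) * Real.exp (-‖x - y‖ ^ 2 / (2 * t))

/-- The Kato class `K(ℝ^m)`: Borel functions `w` with
`lim_{t→0+} sup_x ∫_0^t ∫ p(s,x,y) |w(y)| dy ds = 0`. -/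
def InKatoClass (m : ℕ) (w : Em m → ℂ) : Prop :=
  Tendsto
    (fun t : ℝ => ⨆ x : Em m,
      ∫⁻ s in Set.Ioc (0 : ℝ) t,
        ∫⁻ y, ENNReal.ofReal (heatk m s x y) * (‖w y‖₊ : ℝ≥0∞) ∂volume ∂volume)
    (nhdsWithin 0 (Set.Ioi 0)) (nhds 0)

/-- The iterated time-ordered integrals
`a_n(x,t) = ∫_{0 ≤ q_1 ≤ … ≤ q_n ≤ t} ∫_{(ℝ^m)^n} Π_i p(q_i − q_{i−1}, x_{i−1}, x_i) |w(x_i)| dx dq`,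
with `q_0 = 0`, `x_0 = x`, and `a_0(x,t) = 1`. -/
def aFK (m : ℕ) (w : Em m → ℂ) : ℕ → Em m → ℝ → ℝ≥0∞
  | 0, _, _ => 1
  | n + 1, x, t =>
    ∫⁻ q : Fin (n + 1) → ℝ in
        {q | (∀ i j : Fin (n + 1), i ≤ j → q i ≤ q j) ∧ 0 ≤ q 0 ∧ q (Fin.last n) ≤ t},
      ∫⁻ xs : Fin (n + 1) → Em m,
        ∏ i : Fin (n + 1),
          ENNReal.ofReal
              (heatk m (q i - if i = 0 then 0 else q (i - 1))
                (if i = 0 then x else xs (i - 1)) (xs i)) *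
            (‖w (xs i)‖₊ : ℝ≥0∞)

section Chain

variable {α β : Type*}

/-- The product of transition weights along the path `z, (q 0, xs 0), …, (q (n-1), xs (n-1))`. -/
def chainWeight (K : α × β → α × β → ℝ≥0∞) {n : ℕ} (z : α × β) (q : Fin n → α)
    (xs : Fin n → β) : ℝ≥0∞ :=
  ∏ i : Fin n, K ((Fin.cons z.1 q : Fin (n + 1) → α) i.castSucc,
    (Fin.cons z.2 xs : Fin (n + 1) → β) i.castSucc) (q i, xs i)

theorem chainWeight_cons (K : α × β → α × β → ℝ≥0∞) {n : ℕ} (z : α × β) (a : α) (b : β)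
    (q : Fin n → α) (xs : Fin n → β) :
    chainWeight K z (Fin.cons a q : Fin (n + 1) → α) (Fin.cons b xs : Fin (n + 1) → β) =
      K z (a, b) * chainWeight K (a, b) q xs := by
  simp [chainWeight, Fin.prod_univ_succ]

theorem measurable_fin_cons [MeasurableSpace α] {n : ℕ} :
    Measurable fun p : α × (Fin n → α) => (Fin.cons p.1 p.2 : Fin (n + 1) → α) := by
  refine measurable_pi_lambda _ fun i => ?_
  refine Fin.cases ?_ (fun j => ?_) i
  · simp only [Fin.cons_zero]
    fun_prop
  · simp only [Fin.cons_succ]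
    fun_prop

theorem measurable_chainWeight [MeasurableSpace α] [MeasurableSpace β]
    {K : α × β → α × β → ℝ≥0∞}
    (hK : Measurable (Function.uncurry K)) {n : ℕ} :
    Measurable fun p : (α × β) × (Fin n → α) × (Fin n → β) =>
      chainWeight K p.1 p.2.1 p.2.2 := by
  refine Finset.measurable_prod _ fun i _ => ?_
  have h1 : Measurable fun p : (α × β) × (Fin n → α) × (Fin n → β) =>
      (Fin.cons p.1.1 p.2.1 : Fin (n + 1) → α) :=
    measurable_fin_cons.comp (by fun_prop : Measurable fun p : (α × β) × (Fin n → α) ×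
      (Fin n → β) => (p.1.1, p.2.1))
  have h2 : Measurable fun p : (α × β) × (Fin n → α) × (Fin n → β) =>
      (Fin.cons p.1.2 p.2.2 : Fin (n + 1) → β) :=
    measurable_fin_cons.comp (by fun_prop : Measurable fun p : (α × β) × (Fin n → α) ×
      (Fin n → β) => (p.1.2, p.2.2))
  exact hK.comp ((((measurable_pi_apply _).comp h1).prodMk ((measurable_pi_apply _).comp h2)).prodMk
    (by fun_prop))

variable [MeasureSpace α] [MeasureSpace β]
  [SigmaFinite (volume : Measure α)] [SigmaFinite (volume : Measure β)]

theorem lintegral_pi_fin_succ {n : ℕ} {f : (Fin (n + 1) → α) → ℝ≥0∞} (hf : Measurable f) :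
    ∫⁻ q, f q = ∫⁻ a, ∫⁻ q : Fin n → α, f (Fin.cons a q) := by
  have hmp := (volume_preserving_piFinSuccAbove (fun _ : Fin (n + 1) => α) 0).symm
  rw [← hmp.lintegral_comp hf, Measure.volume_eq_prod, lintegral_prod _ (by fun_prop)]
  simp [MeasurableEquiv.piFinSuccAbove_symm_apply, Fin.insertNthEquiv_zero, Fin.consEquiv]

/-- If `u ≥ 1` satisfies `K u ≤ ε u`, then the `n`-fold iterate of `K` is at most `ε ^ n * u`. -/
theorem lintegral_chainWeight_le {K : α × β → α × β → ℝ≥0∞}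
    (hK : Measurable (Function.uncurry K)) {u : α × β → ℝ≥0∞} (hu : ∀ z, 1 ≤ u z)
    {ε : ℝ≥0∞} (hε : ε ≠ ∞) (hKu : ∀ z, ∫⁻ a, ∫⁻ b, K z (a, b) * u (a, b) ≤ ε * u z)
    (n : ℕ) (z : α × β) :
    ∫⁻ q : Fin n → α, ∫⁻ xs : Fin n → β, chainWeight K z q xs ≤ ε ^ n * u z := by
  induction n generalizing z with
  | zero => simpa [chainWeight, volume_pi, Measure.pi_of_empty] using hu z
  | succ n ih =>
    have hW := measurable_chainWeight hK (n := n)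
    have hW' := measurable_chainWeight hK (n := n + 1)
    have hKm : Measurable fun p : (α × β) × (α × β) => K p.1 p.2 := hK
    calc ∫⁻ q : Fin (n + 1) → α, ∫⁻ xs : Fin (n + 1) → β, chainWeight K z q xs
        = ∫⁻ a, ∫⁻ q : Fin n → α, ∫⁻ b, ∫⁻ xs : Fin n → β,
            K z (a, b) * chainWeight K (a, b) q xs := by
          rw [lintegral_pi_fin_succ]
          · refine lintegral_congr fun a => lintegral_congr fun q => ?_
            rw [lintegral_pi_fin_succ]
            · simp only [chainWeight_cons]
            · exact hW'.comp (by fun_prop : Measurable fun xs : Fin (n + 1) → β =>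
                (z, (Fin.cons a q : Fin (n + 1) → α), xs))
          · refine Measurable.lintegral_prod_right ?_
            exact hW'.comp (by fun_prop : Measurable fun p : (Fin (n + 1) → α) ×
              (Fin (n + 1) → β) => (z, p))
      _ = ∫⁻ a, ∫⁻ b, ∫⁻ q : Fin n → α, ∫⁻ xs : Fin n → β,
            K z (a, b) * chainWeight K (a, b) q xs := by
          refine lintegral_congr fun a => lintegral_lintegral_swap ?_
          refine Measurable.aemeasurable (Measurable.lintegral_prod_right ?_)
          refine Measurable.mul (f := fun p : ((Fin n → α) × β) × (Fin n → β) => K z (a, p.1.2))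
            ?_ ?_
          · exact hKm.comp (by fun_prop : Measurable fun p : ((Fin n → α) × β) × (Fin n → β) =>
              (z, (a, p.1.2)))
          · exact hW.comp (by fun_prop : Measurable fun p : ((Fin n → α) × β) × (Fin n → β) =>
              ((a, p.1.2), p.1.1, p.2))
      _ = ∫⁻ a, ∫⁻ b, K z (a, b) * ∫⁻ q : Fin n → α, ∫⁻ xs : Fin n → β,
            chainWeight K (a, b) q xs := by
          refine lintegral_congr fun a => lintegral_congr fun b => ?_
          have hab : Measurable fun p : (Fin n → α) × (Fin n → β) =>
              chainWeight K (a, b) p.1 p.2 := hW.comp (by fun_prop :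
                Measurable fun p : (Fin n → α) × (Fin n → β) => ((a, b), p))
          rw [← lintegral_const_mul _ hab.lintegral_prod_right']
          refine lintegral_congr fun q => lintegral_const_mul _ ?_
          exact hab.comp (by fun_prop : Measurable fun xs : Fin n → β => (q, xs))
      _ ≤ ∫⁻ a, ∫⁻ b, ε ^ n * (K z (a, b) * u (a, b)) := by
          refine lintegral_mono fun a => lintegral_mono fun b => ?_
          calc _ ≤ K z (a, b) * (ε ^ n * u (a, b)) := by gcongr; exact ih (a, b)
            _ = _ := by ring
      _ = ε ^ n * ∫⁻ a, ∫⁻ b, K z (a, b) * u (a, b) := by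
          simp_rw [lintegral_const_mul' _ _ (ENNReal.pow_ne_top hε)]
      _ ≤ ε ^ n * (ε * u z) := by gcongr; exact hKu z
      _ = ε ^ (n + 1) * u z := by ring

end Chain

section HeatKernel

variable {m : ℕ}

theorem heatk_nonneg {t : ℝ} (ht : 0 ≤ t) (x y : Em m) : 0 ≤ heatk m t x y := by
  unfold heatk; positivity

theorem heatk_zero (hm : 1 ≤ m) (x y : Em m) : heatk m 0 x y = 0 := by
  have : -(m : ℝ) / 2 ≠ 0 := by
    have : (0 : ℝ) < m := by exact_mod_cast hm
    exact div_ne_zero (by linarith) two_ne_zero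
  simp [heatk, Real.zero_rpow this]

theorem heatk_comm (t : ℝ) (x y : Em m) : heatk m t x y = heatk m t y x := by
  rw [heatk, heatk, norm_sub_rev]

theorem measurable_ofReal_heatk {γ : Type*} [MeasurableSpace γ] {t : γ → ℝ} {x y : γ → Em m}
    (ht : Measurable t) (hx : Measurable x) (hy : Measurable y) :
    Measurable fun c => ENNReal.ofReal (heatk m (t c) (x c) (y c)) := by
  unfold heatk; fun_prop

theorem lintegral_heatk {t : ℝ} (ht : 0 < t) (x : Em m) :
    ∫⁻ y, ENNReal.ofReal (heatk m t x y) = 1 := by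
  have hint : ∫ y, heatk m t x y = 1 := by
    simp_rw [heatk_comm t x, heatk]
    rw [integral_sub_right_eq_self
      (fun z : Em m => (2 * Real.pi * t) ^ (-(m : ℝ) / 2) * Real.exp (-‖z‖ ^ 2 / (2 * t))) x,
      integral_const_mul]
    have h := GaussianFourier.integral_rexp_neg_mul_sq_norm (V := Em m)
      (b := 1 / (2 * t)) (by positivity)
    have e : ∀ z : Em m, -‖z‖ ^ 2 / (2 * t) = -(1 / (2 * t)) * ‖z‖ ^ 2 := fun z => by ring
    simp_rw [e]
    rw [h, finrank_euclideanSpace_fin, show Real.pi / (1 / (2 * t)) = 2 * Real.pi * t by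
      field_simp, ← Real.rpow_add (by positivity)]
    simp [neg_div]
  rw [← ofReal_integral_eq_lintegral_ofReal
    (Integrable.of_integral_ne_zero (by rw [hint]; exact one_ne_zero))
    (Eventually.of_forall fun y => heatk_nonneg ht.le x y), hint, ENNReal.ofReal_one]

theorem heatk_mul_heatk {s r : ℝ} (hs : 0 < s) (hr : 0 < r) (x y z : Em m) :
    heatk m s x z * heatk m r z y =
      heatk m (s + r) x y *
        heatk m (s * r / (s + r)) ((r / (s + r)) • x + (s / (s + r)) • y) z := by
  have hc : (2 * Real.pi * s) ^ (-(m : ℝ) / 2) * (2 * Real.pi * r) ^ (-(m : ℝ) / 2) =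
      (2 * Real.pi * (s + r)) ^ (-(m : ℝ) / 2) *
        (2 * Real.pi * (s * r / (s + r))) ^ (-(m : ℝ) / 2) := by
    rw [← Real.mul_rpow (by positivity) (by positivity),
      ← Real.mul_rpow (by positivity) (by positivity)]
    congr 1
    field_simp
  have hsr : s + r ≠ 0 := by positivity
  have hxy : x - y = (x - z) + (z - y) := by abel
  have hcz : (r / (s + r)) • x + (s / (s + r)) • y - z =
      (r / (s + r)) • (x - z) - (s / (s + r)) • (z - y) := by
    have hz : z = (r / (s + r) + s / (s + r)) • z := by
      rw [← add_div, add_comm r s, div_self hsr, one_smul]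
    conv_lhs => rw [hz]
    module
  have he : -‖x - z‖ ^ 2 / (2 * s) + -‖z - y‖ ^ 2 / (2 * r) =
      -‖x - y‖ ^ 2 / (2 * (s + r)) +
        -‖(r / (s + r)) • x + (s / (s + r)) • y - z‖ ^ 2 / (2 * (s * r / (s + r))) := by
    rw [hcz, hxy, norm_add_sq_real, norm_sub_sq_real (_ • _), norm_smul, norm_smul, real_inner_smul_left,
      real_inner_smul_right, mul_pow, mul_pow, Real.norm_eq_abs, Real.norm_eq_abs, sq_abs, sq_abs]
    field_simp
    ring
  unfold heatk
  rw [mul_mul_mul_comm, hc, ← Real.exp_add, he, Real.exp_add, mul_mul_mul_comm]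

theorem lintegral_heatk_mul_heatk {s r : ℝ} (hs : 0 < s) (hr : 0 < r) (x y : Em m) :
    ∫⁻ z, ENNReal.ofReal (heatk m s x z) * ENNReal.ofReal (heatk m r z y) =
      ENNReal.ofReal (heatk m (s + r) x y) := by
  simp_rw [← ENNReal.ofReal_mul (heatk_nonneg hs.le _ _), heatk_mul_heatk hs hr,
    ENNReal.ofReal_mul (heatk_nonneg (add_pos hs hr).le _ _)]
  rw [lintegral_const_mul' _ _ ENNReal.ofReal_ne_top, lintegral_heatk (by positivity), mul_one]

/-- The heat semigroup applied to a nonnegative function. -/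
def heatSemigroup (f : Em m → ℝ≥0∞) (t : ℝ) (x : Em m) : ℝ≥0∞ :=
  ∫⁻ y, ENNReal.ofReal (heatk m t x y) * f y

variable {f : Em m → ℝ≥0∞}

theorem measurable_heatSemigroup (hf : Measurable f) :
    Measurable fun p : ℝ × Em m => heatSemigroup f p.1 p.2 := by
  refine Measurable.lintegral_prod_right ?_
  exact (measurable_ofReal_heatk (measurable_fst.comp measurable_fst)
    (measurable_snd.comp measurable_fst) measurable_snd).mul (hf.comp measurable_snd)

theorem heatSemigroup_add (hf : Measurable f) {s r : ℝ} (hs : 0 < s) (hr : 0 < r) (x : Em m) :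
    heatSemigroup f (s + r) x =
      ∫⁻ z, ENNReal.ofReal (heatk m s x z) * heatSemigroup f r z := by
  have h1 : Measurable fun p : Em m × Em m => ENNReal.ofReal (heatk m s x p.1) :=
    measurable_ofReal_heatk measurable_const measurable_const measurable_fst
  have h2 : Measurable fun p : Em m × Em m => ENNReal.ofReal (heatk m r p.1 p.2) :=
    measurable_ofReal_heatk measurable_const measurable_fst measurable_snd
  calc heatSemigroup f (s + r) x
      = ∫⁻ y, ∫⁻ z, ENNReal.ofReal (heatk m s x z) * (ENNReal.ofReal (heatk m r z y) * f y) := by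
        refine lintegral_congr fun y => ?_
        have h12 : Measurable fun z : Em m =>
            ENNReal.ofReal (heatk m s x z) * ENNReal.ofReal (heatk m r z y) :=
          (measurable_ofReal_heatk measurable_const measurable_const measurable_id).mul
            (measurable_ofReal_heatk measurable_const measurable_id measurable_const)
        rw [← lintegral_heatk_mul_heatk hs hr, ← lintegral_mul_const _ h12]
        simp_rw [mul_assoc]
    _ = ∫⁻ z, ∫⁻ y, ENNReal.ofReal (heatk m s x z) * (ENNReal.ofReal (heatk m r z y) * f y) := by
        refine (lintegral_lintegral_swap ?_).symm
        exact (h1.mul (h2.mul (hf.comp measurable_snd))).aemeasurable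
    _ = ∫⁻ z, ENNReal.ofReal (heatk m s x z) * heatSemigroup f r z :=
        lintegral_congr fun z => lintegral_const_mul' _ _ ENNReal.ofReal_ne_top

theorem setLIntegral_heatSemigroup_le (hf : Measurable f) {τ : ℝ} {η : ℝ≥0∞}
    (hη : ∀ x, ∫⁻ s in Set.Ioc 0 τ, heatSemigroup f s x ≤ η) {a : ℝ} (ha : 0 ≤ a) (x : Em m) :
    ∫⁻ s in Set.Ioc a (a + τ), heatSemigroup f s x ≤ η := by
  rcases ha.eq_or_lt with rfl | ha
  · simpa using hη x
  have hm1 : Measurable fun z : Em m => ENNReal.ofReal (heatk m a x z) :=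
    measurable_ofReal_heatk measurable_const measurable_const measurable_id
  calc ∫⁻ s in Set.Ioc a (a + τ), heatSemigroup f s x
      = ∫⁻ r in Set.Ioc 0 τ, heatSemigroup f (a + r) x := by
        rw [← (measurePreserving_add_left volume a).setLIntegral_comp_preimage_emb
          (measurableEmbedding_addLeft a)]
        simp
    _ = ∫⁻ r in Set.Ioc 0 τ, ∫⁻ z, ENNReal.ofReal (heatk m a x z) * heatSemigroup f r z :=
        setLIntegral_congr_fun measurableSet_Ioc fun r hr => heatSemigroup_add hf ha hr.1 x
    _ = ∫⁻ z, ENNReal.ofReal (heatk m a x z) * ∫⁻ r in Set.Ioc 0 τ, heatSemigroup f r z := by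
        rw [lintegral_lintegral_swap]
        · simp_rw [lintegral_const_mul' _ _ ENNReal.ofReal_ne_top]
        · exact ((hm1.comp measurable_snd).mul (measurable_heatSemigroup hf)).aemeasurable
    _ ≤ ∫⁻ z, ENNReal.ofReal (heatk m a x z) * η := by
        gcongr with z; exact hη z
    _ = η := by rw [lintegral_mul_const _ hm1, lintegral_heatk ha, one_mul]

end HeatKernel

theorem lintegral_exp_mul_le_two_mul {g : ℝ → ℝ≥0∞} {τ : ℝ} (hτ : 0 < τ) {η : ℝ≥0∞}
    (hg : ∀ a, 0 ≤ a → ∫⁻ s in Set.Ioc a (a + τ), g s ≤ η) :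
    ∫⁻ s in Set.Ioi 0, ENNReal.ofReal (Real.exp (-(Real.log 2 / τ * s))) * g s ≤ 2 * η := by
  have hcover : Set.Ioi (0 : ℝ) ⊆ ⋃ k : ℕ, Set.Ioc (k * τ) (k * τ + τ) := by
    intro s hs
    have hs : 0 < s := hs
    have hpos : 0 < ⌈s / τ⌉₊ := Nat.ceil_pos.2 (by positivity)
    obtain ⟨k, hk⟩ : ∃ k, ⌈s / τ⌉₊ = k + 1 := ⟨_, (Nat.succ_pred_eq_of_pos hpos).symm⟩
    have h := (Nat.ceil_eq_iff (by omega)).1 hk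
    rw [lt_div_iff₀ hτ, div_le_iff₀ hτ] at h
    refine Set.mem_iUnion.2 ⟨k, ?_, ?_⟩
    · simpa using h.1
    · have := h.2; push_cast at this; linarith
  have hlog := Real.log_pos one_lt_two
  calc ∫⁻ s in Set.Ioi 0, ENNReal.ofReal (Real.exp (-(Real.log 2 / τ * s))) * g s
      ≤ ∫⁻ s in ⋃ k : ℕ, Set.Ioc (k * τ) (k * τ + τ),
          ENNReal.ofReal (Real.exp (-(Real.log 2 / τ * s))) * g s := lintegral_mono_set hcover
    _ ≤ ∑' k : ℕ, ∫⁻ s in Set.Ioc (k * τ) (k * τ + τ),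
          ENNReal.ofReal (Real.exp (-(Real.log 2 / τ * s))) * g s := lintegral_iUnion_le _ _
    _ ≤ ∑' k : ℕ, 2⁻¹ ^ k * η := by
        refine ENNReal.tsum_le_tsum fun k => ?_
        calc _ ≤ ∫⁻ s in Set.Ioc (k * τ) (k * τ + τ), 2⁻¹ ^ k * g s := by
              refine setLIntegral_mono' measurableSet_Ioc fun s hs => ?_
              gcongr
              have h : Real.exp (-(Real.log 2 / τ * (k * τ))) = 2⁻¹ ^ k := by
                rw [show -(Real.log 2 / τ * (k * τ)) = k * -Real.log 2 by field_simp,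
                  Real.exp_nat_mul, Real.exp_neg, Real.exp_log two_pos]
              calc _ ≤ ENNReal.ofReal (2⁻¹ ^ k) := by
                    rw [← h]
                    gcongr
                    exact hs.1.le
                _ = 2⁻¹ ^ k := by
                    rw [ENNReal.ofReal_pow (by norm_num), ENNReal.ofReal_inv_of_pos two_pos]
                    simp
          _ = 2⁻¹ ^ k * ∫⁻ s in Set.Ioc (k * τ) (k * τ + τ), g s :=
              lintegral_const_mul' _ _ (ENNReal.pow_ne_top (by simp))
          _ ≤ _ := by gcongr; exact hg _ (by positivity)
    _ = 2 * η := by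
        rw [ENNReal.tsum_mul_right, ENNReal.tsum_geometric, ENNReal.one_sub_inv_two, inv_inv]

section FeynmanKac

variable {m : ℕ}

/-- The transition weight `p(r - s, x, y) |w y|` from `(s, x)` to `(r, y)`, for `s ≤ r ≤ t`. -/
def heatWeight (w : Em m → ℂ) (t : ℝ) (z z' : ℝ × Em m) : ℝ≥0∞ :=
  {p : ℝ × ℝ | p.1 ≤ p.2 ∧ p.2 ≤ t}.indicator (fun p =>
    ENNReal.ofReal (heatk m (p.2 - p.1) z.2 z'.2) * (‖w z'.2‖₊ : ℝ≥0∞)) (z.1, z'.1)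

theorem measurable_heatWeight {w : Em m → ℂ} (hw : Measurable w) (t : ℝ) :
    Measurable (Function.uncurry (heatWeight w t)) := by
  have hS : MeasurableSet {p : (ℝ × Em m) × (ℝ × Em m) | p.1.1 ≤ p.2.1 ∧ p.2.1 ≤ t} :=
    (measurableSet_le (measurable_fst.comp measurable_fst)
      (measurable_fst.comp measurable_snd)).inter
      (measurableSet_le (measurable_fst.comp measurable_snd) measurable_const)
  have hF : Measurable fun p : (ℝ × Em m) × (ℝ × Em m) =>
      ENNReal.ofReal (heatk m (p.2.1 - p.1.1) p.1.2 p.2.2) * (‖w p.2.2‖₊ : ℝ≥0∞) :=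
    (measurable_ofReal_heatk (by fun_prop) (by fun_prop) (by fun_prop)).mul (by fun_prop)
  exact hF.indicator hS

theorem aFK_succ_le_lintegral_chainWeight {w : Em m → ℂ} (hw : Measurable w) (n : ℕ) (x : Em m)
    (t : ℝ) :
    aFK m w (n + 1) x t ≤ ∫⁻ q : Fin (n + 1) → ℝ, ∫⁻ xs : Fin (n + 1) → Em m,
      chainWeight (heatWeight w t) (0, x) q xs := by
  have hW := (measurable_chainWeight (measurable_heatWeight hw t) (n := n + 1)).comp
    (by fun_prop : Measurable fun p : (Fin (n + 1) → ℝ) × (Fin (n + 1) → Em m) =>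
      (((0 : ℝ), x), p))
  refine le_trans ?_ (setLIntegral_le_lintegral
    {q | (∀ i j : Fin (n + 1), i ≤ j → q i ≤ q j) ∧ 0 ≤ q 0 ∧ q (Fin.last n) ≤ t} _)
  refine setLIntegral_mono hW.lintegral_prod_right' fun q hq => lintegral_mono fun xs => ?_
  obtain ⟨hmono, h0, ht⟩ := hq
  refine (Finset.prod_congr rfl fun i _ => ?_).le
  have hit : q i ≤ t := (hmono _ _ (Fin.le_last i)).trans ht
  rw [heatWeight]
  induction i using Fin.cases with
  | zero =>
    rw [Set.indicator_of_mem]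
    · simp
    · exact ⟨by simpa using h0, hit⟩
  | succ j =>
    have hj : j.succ - 1 = j.castSucc := by
      obtain ⟨n, rfl⟩ := Nat.exists_eq_succ_of_ne_zero (Fin.pos j).ne'
      simp [← Fin.coeSucc_eq_succ]
    rw [Set.indicator_of_mem]
    · simp [hj, Fin.succ_ne_zero]
    · exact ⟨by simpa [← Fin.succ_castSucc] using hmono _ _ j.castSucc_lt_succ.le, hit⟩

theorem lintegral_heatWeight_mul_exp_le (hm : 1 ≤ m) {w : Em m → ℂ} {lam : ℝ} {ε : ℝ≥0∞}
    (hε : ∀ x, ∫⁻ s in Set.Ioi 0, ENNReal.ofReal (Real.exp (-(lam * s))) *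
      heatSemigroup (fun y => (‖w y‖₊ : ℝ≥0∞)) s x ≤ ε) (t : ℝ)
    (z : ℝ × Em m) :
    ∫⁻ a, ∫⁻ b, heatWeight w t z (a, b) *
        ENNReal.ofReal (Real.exp (lam * max (t - a) 0)) ≤
      ε * ENNReal.ofReal (Real.exp (lam * max (t - z.1) 0)) := by
  set U := ENNReal.ofReal (Real.exp (lam * max (t - z.1) 0)) with hU
  set G : ℝ → ℝ≥0∞ := (Set.Ioi 0).indicator fun s =>
    ENNReal.ofReal (Real.exp (-(lam * s))) *
      heatSemigroup (fun y => (‖w y‖₊ : ℝ≥0∞)) s z.2 with hG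
  calc _ ≤ ∫⁻ a, U * G (a - z.1) := by
        refine lintegral_mono fun a => ?_
        by_cases ha : z.1 < a ∧ a ≤ t
        · have hpos : a - z.1 ∈ Set.Ioi (0 : ℝ) := sub_pos.2 ha.1
          rw [hG, Set.indicator_of_mem hpos, ← mul_assoc, heatSemigroup,
            ← lintegral_const_mul' _ _ (by finiteness)]
          refine lintegral_mono fun b => ?_
          have hmem : (z.1, a) ∈ {p : ℝ × ℝ | p.1 ≤ p.2 ∧ p.2 ≤ t} := ⟨ha.1.le, ha.2⟩
          rw [heatWeight, Set.indicator_of_mem hmem, mul_comm]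
          dsimp only
          gcongr
          rw [hU, ← ENNReal.ofReal_mul (by positivity), ← Real.exp_add]
          gcongr
          rw [max_eq_left (by linarith [ha.2]), max_eq_left (by linarith [ha.1, ha.2])]
          linarith
        · refine le_of_eq_of_le ?_ zero_le
          refine (lintegral_congr fun b => ?_).trans lintegral_zero
          rw [heatWeight, Set.indicator_apply]
          split_ifs with h
          · have : a = z.1 := le_antisymm (not_lt.1 fun h' => ha ⟨h', h.2⟩) h.1
            simp [this, heatk_zero hm]
          · simp
    _ = U * ∫⁻ a, G (a - z.1) := lintegral_const_mul' _ _ (by finiteness)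
    _ = U * ∫⁻ a, G a := by rw [lintegral_sub_right_eq_self G z.1]
    _ ≤ ε * U := by
        rw [mul_comm, hG, lintegral_indicator measurableSet_Ioi]
        gcongr
        exact hε z.2

theorem aFK_le (hm : 1 ≤ m) {w : Em m → ℂ} (hw : Measurable w) {lam : ℝ} {ε : ℝ≥0∞}
    (hε' : ε ≠ ∞)
    (hε : ∀ x, ∫⁻ s in Set.Ioi 0, ENNReal.ofReal (Real.exp (-(lam * s))) *
      heatSemigroup (fun y => (‖w y‖₊ : ℝ≥0∞)) s x ≤ ε) (hlam : 0 ≤ lam) {t : ℝ} (ht : 0 ≤ t)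
    (n : ℕ) (x : Em m) :
    aFK m w n x t ≤ ε ^ n * ENNReal.ofReal (Real.exp (t * lam)) := by
  have hu (a : ℝ) : 1 ≤ ENNReal.ofReal (Real.exp (lam * max a 0)) := by
    rw [ENNReal.one_le_ofReal]
    exact Real.one_le_exp (by positivity)
  have h0 : ENNReal.ofReal (Real.exp (lam * max (t - 0) 0)) =
      ENNReal.ofReal (Real.exp (t * lam)) := by
    rw [sub_zero, max_eq_left ht, mul_comm]
  cases n with
  | zero => simpa only [aFK, h0, pow_zero, one_mul] using hu (t - 0)
  | succ n =>
    rw [← h0]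
    exact (aFK_succ_le_lintegral_chainWeight hw n x t).trans
      (lintegral_chainWeight_le (measurable_heatWeight hw t)
        (u := fun z => ENNReal.ofReal (Real.exp (lam * max (t - z.1) 0)))
        (fun z => hu _) hε' (lintegral_heatWeight_mul_exp_le hm hε t) (n + 1) (0, x))

end FeynmanKac

/-- for `w` in the Kato class `K(ℝ^m)` and any `δ > 1` there is a
constant `C = C(w,δ) > 0` such that for all `t ≥ 0` the Feynman–Kac expectation
satisfies `sup_x Σ_{n=0}^∞ a_n(x,t) ≤ δ e^{tC}`. -/
theorem kato_exponential_bound (m : ℕ) (hm : 1 ≤ m) (w : Em m → ℂ)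
    (hw : Measurable w) (hkato : InKatoClass m w) :
    ∀ δ : ℝ, 1 < δ → ∃ C : ℝ, 0 < C ∧ ∀ t : ℝ, 0 ≤ t →
      (⨆ x : Em m, ∑' n : ℕ, aFK m w n x t) ≤ ENNReal.ofReal (δ * Real.exp (t * C)) := by
  intro δ hδ
  have hδ0 : 0 < δ := one_pos.trans hδ
  have hε : 0 < 1 - δ⁻¹ := sub_pos.2 (inv_lt_one_of_one_lt₀ hδ)
  obtain ⟨τ, hτη, (hτ : 0 < τ)⟩ := ((Tendsto.eventually_le_const
    (ENNReal.ofReal_pos.2 (half_pos hε)) hkato).and self_mem_nhdsWithin).exists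
  have hf : Measurable fun y => (‖w y‖₊ : ℝ≥0∞) := by fun_prop
  have hlam : 0 < Real.log 2 / τ := div_pos (Real.log_pos one_lt_two) hτ
  have hpot (x : Em m) : ∫⁻ s in Set.Ioi 0, ENNReal.ofReal (Real.exp (-(Real.log 2 / τ * s))) *
      heatSemigroup (fun y => (‖w y‖₊ : ℝ≥0∞)) s x ≤ ENNReal.ofReal (1 - δ⁻¹) := by
    refine (lintegral_exp_mul_le_two_mul hτ fun a ha => setLIntegral_heatSemigroup_le hf
      (fun y => (iSup_le_iff.1 hτη) y) ha x).trans_eq ?_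
    rw [← ENNReal.ofReal_ofNat 2, ← ENNReal.ofReal_mul zero_le_two, mul_div_cancel₀ _ two_ne_zero]
  refine ⟨Real.log 2 / τ, hlam, fun t ht => iSup_le fun x => ?_⟩
  calc ∑' n : ℕ, aFK m w n x t
      ≤ ∑' n : ℕ, ENNReal.ofReal (1 - δ⁻¹) ^ n *
          ENNReal.ofReal (Real.exp (t * (Real.log 2 / τ))) :=
        ENNReal.tsum_le_tsum fun n => aFK_le hm hw ENNReal.ofReal_ne_top hpot hlam.le ht n x
    _ = ENNReal.ofReal (δ * Real.exp (t * (Real.log 2 / τ))) := by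
        rw [ENNReal.tsum_mul_right, ENNReal.tsum_geometric, ← ENNReal.ofReal_one,
          ← ENNReal.ofReal_sub _ hε.le, _root_.sub_sub_cancel, ENNReal.ofReal_inv_of_pos hδ0, inv_inv,
          ENNReal.ofReal_mul hδ0.le]
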